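/- arXiv:1910.10990 — 2 statements merged into one kernel-verified Lean document; each statement's English description precedes it below -/
import Mathlib

section
/- For all natural numbers n and k with 1 ≤ k ≤ n, the k-th derivative of the n-th Chebyshev polynomial of the second kind satisfies d^k/dx^k U_n(x) = 2^k · Σ_{i=0}^{⌊(n−k)/2⌋} (n−i)^{\underline{k−1}} · C(k+i−1, k−1) · (n−k−2i+1) · U_{n−k−2i}(x). -/
open Polynomial Polynomial.Chebyshev

/-- The falling factorial a(a-1)⋯(a-m+1). -/
noncomputable def fallFac (a : ℝ) (m : ℕ) : ℝ := ∏ j ∈ Finset.range m, (a - j)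

lemma fallFac_top (a : ℝ) (m : ℕ) : fallFac a (m + 1) = fallFac a m * (a - m) := by
  simp [fallFac, Finset.prod_range_succ]

lemma fallFac_bot (a : ℝ) (m : ℕ) : fallFac a (m + 1) = a * fallFac (a - 1) m := by
  unfold fallFac
  rw [Finset.prod_range_succ', mul_comm]
  congr 1
  · simp
  · refine Finset.prod_congr rfl fun j _ => ?_
    push_cast
    ring

/-- The coefficient, with `k = j + 1` and `n = k + m`. -/
noncomputable def cf (j m i : ℕ) : ℝ :=
  fallFac ((j : ℝ) + 1 + m - i) j * (Nat.choose (j + i) j : ℝ) * ((m : ℝ) - 2 * i + 1)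

noncomputable def rhs (j m : ℕ) : ℝ[X] :=
  ∑ i ∈ Finset.range (m / 2 + 1), C (cf j m i) * U ℝ ((m - 2 * i : ℕ))

lemma cf_zero (j m : ℕ) : cf (j + 1) m 0 = ((j : ℝ) + 2 + m) * cf j m 0 := by
  unfold cf
  rw [fallFac_bot]
  have : (((j + 1 : ℕ) : ℝ) + 1 + m - (0 : ℕ) - 1) = (j : ℝ) + 1 + m - (0 : ℕ) := by
    push_cast; ring
  rw [this]
  simp
  ring

lemma cf_succ (j m i : ℕ) :
    cf (j + 1) (m + 2) (i + 1) = cf (j + 1) m i + ((j : ℝ) + 4 + m) * cf j (m + 2) (i + 1) := by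
  unfold cf
  have e1 : (((j + 1 : ℕ) : ℝ) + 1 + (m + 2 : ℕ) - (i + 1 : ℕ)) = (j : ℝ) + 3 + m - i := by
    push_cast; ring
  have e2 : (((j + 1 : ℕ) : ℝ) + 1 + m - i) = (j : ℝ) + 2 + m - i := by
    push_cast; ring
  have e3 : ((j : ℝ) + 1 + (m + 2 : ℕ) - (i + 1 : ℕ)) = (j : ℝ) + 2 + m - i := by
    push_cast; ring
  rw [e1, e2, e3, fallFac_bot, fallFac_top]
  have e4 : (j : ℝ) + 3 + m - i - 1 = (j : ℝ) + 2 + m - i := by ring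
  rw [e4]
  have c1 : (j + 1 + (i + 1)).choose (j + 1)
      = (j + 1 + i).choose j + (j + 1 + i).choose (j + 1) := by
    rw [show j + 1 + (i + 1) = (j + 1 + i) + 1 by ring, Nat.choose_succ_succ]
  have c2 : (j + 1 + i).choose (j + 1) * (j + 1) = (j + 1 + i).choose j * (i + 1) := by
    rw [Nat.choose_succ_right_eq]
    congr 1
    omega
  have c3 : j + (i + 1) = j + 1 + i := by ring
  rw [c1, c3]
  have c2' : ((j + 1 + i).choose (j + 1) : ℝ) * (j + 1) = (j + 1 + i).choose j * (i + 1) := by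
    exact_mod_cast c2
  generalize ((j + 1 + i).choose (j + 1) : ℕ) = B at *
  generalize ((j + 1 + i).choose j : ℕ) = A at *
  generalize fallFac ((j : ℝ) + 2 + m - i) j = F at *
  push_cast
  linear_combination F * ((m : ℝ) - 2 * i + 1) * c2'

lemma rhs_step (j m : ℕ) :
    rhs (j + 1) (m + 2) = rhs (j + 1) m + C ((j : ℝ) + 4 + m) * rhs j (m + 2) := by
  unfold rhs
  rw [show (m + 2) / 2 + 1 = (m / 2 + 1) + 1 by omega]
  rw [Finset.sum_range_succ', Finset.sum_range_succ' (fun i => C (cf j (m + 2) i) * _),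
    mul_add, ← add_assoc, Finset.mul_sum, ← Finset.sum_add_distrib]
  congr 1
  · refine Finset.sum_congr rfl fun i _ => ?_
    rw [cf_succ, show m + 2 - 2 * (i + 1) = m - 2 * i by omega, Polynomial.C_add, Polynomial.C_mul]
    ring
  · rw [cf_zero, Polynomial.C_mul]
    push_cast
    rw [show (j : ℝ) + 2 + (m + 2) = (j : ℝ) + 4 + m by ring]
    ring

lemma deriv_step (n : ℤ) :
    derivative (U ℝ (n + 2)) = derivative (U ℝ n) + C (2 * ((n : ℝ) + 2)) * U ℝ (n + 1) := by
  have h := congrArg derivative (U_eq_two_mul_T_add_U ℝ n)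
  rw [h, derivative_add, ← Polynomial.C_ofNat, derivative_C_mul, T_derivative_eq_U,
    show n + 2 - 1 = n + 1 by ring]
  push_cast
  simp only [Polynomial.C_mul, Polynomial.C_add, map_intCast, map_ofNat]
  ring

lemma iter_step (n : ℤ) (k : ℕ) :
    derivative^[k + 1] (U ℝ (n + 2)) = derivative^[k + 1] (U ℝ n) +
      C (2 * ((n : ℝ) + 2)) * derivative^[k] (U ℝ (n + 1)) := by
  rw [Function.iterate_succ_apply, deriv_step, iterate_map_add, iterate_derivative_C_mul,
    Function.iterate_succ_apply]

lemma iter_zero (n k : ℕ) (h : n < k) : derivative^[k] (U ℝ (n : ℤ)) = 0 := by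
  apply iterate_derivative_eq_zero
  rwa [natDegree_U_natCast]

lemma key : ∀ j m : ℕ,
    derivative^[j + 1] (U ℝ ((j + 1 + m : ℕ) : ℤ)) = C ((2 : ℝ) ^ (j + 1)) * rhs j m := by
  intro j
  induction j with
  | zero =>
    intro m
    induction m using Nat.twoStepInduction with
    | zero =>
      simp [rhs, cf, fallFac]
      rfl
    | one =>
      simp [rhs, cf, fallFac, U_two]
      simp only [map_ofNat]
      ring
    | more m h _ =>
      have := iter_step ((m + 1 : ℕ) : ℤ) 0
      rw [show ((0 + 1 + (m + 2) : ℕ) : ℤ) = ((m + 1 : ℕ) : ℤ) + 2 by push_cast; ring, this,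
        show ((m + 1 : ℕ) : ℤ) = ((0 + 1 + m : ℕ) : ℤ) by push_cast; ring, h]
      unfold rhs
      rw [show (m + 2) / 2 + 1 = (m / 2 + 1) + 1 by omega,
        Finset.sum_range_succ' (fun i => Polynomial.C (cf 0 (m + 2) i) * _)]
      have e1 : ∀ i, cf 0 (m + 2) (i + 1) = cf 0 m i := by
        intro i
        simp [cf, fallFac]
        ring
      have e2 : ∀ i, m + 2 - 2 * (i + 1) = m - 2 * i := fun i => by omega
      simp only [e1, e2]
      rw [show ((0 + 1 + m : ℕ) : ℤ) + 1 = ((m + 2 - 2 * 0 : ℕ) : ℤ) by push_cast; ring,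
        show 2 * ((((0 + 1 + m : ℕ) : ℤ) : ℝ) + 2) = 2 ^ (0 + 1) * cf 0 (m + 2) 0 by
          simp [cf, fallFac]
          ring,
        Polynomial.C_mul, mul_assoc, mul_add]
      rfl
  | succ j ih =>
    intro m
    induction m using Nat.twoStepInduction with
    | zero =>
      have := iter_step (j : ℤ) (j + 1)
      rw [show ((j + 1 + 1 + 0 : ℕ) : ℤ) = (j : ℤ) + 2 by push_cast; ring, this,
        iter_zero _ _ (by omega), show (j : ℤ) + 1 = ((j + 1 + 0 : ℕ) : ℤ) by push_cast; ring, ih]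
      simp only [rhs, Nat.zero_div, zero_add, Finset.sum_range_one, cf_zero, Polynomial.C_mul, pow_succ]
      simp
      ring
    | one =>
      have := iter_step ((j + 1 : ℕ) : ℤ) (j + 1)
      rw [show ((j + 1 + 1 + 1 : ℕ) : ℤ) = ((j + 1 : ℕ) : ℤ) + 2 by push_cast; ring, this,
        iter_zero _ _ (by omega),
        show ((j + 1 : ℕ) : ℤ) + 1 = ((j + 1 + 1 : ℕ) : ℤ) by push_cast; ring, ih]
      simp only [rhs, show 1 / 2 = 0 from rfl, zero_add, Finset.sum_range_one, cf_zero, Polynomial.C_mul,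
        pow_succ]
      simp
      ring
    | more m h _ =>
      have := iter_step ((j + 1 + 1 + m : ℕ) : ℤ) (j + 1)
      rw [show ((j + 1 + 1 + (m + 2) : ℕ) : ℤ) = ((j + 1 + 1 + m : ℕ) : ℤ) + 2 by push_cast; ring,
        this, h,
        show ((j + 1 + 1 + m : ℕ) : ℤ) + 1 = ((j + 1 + (m + 2) : ℕ) : ℤ) by push_cast; ring,
        ih, rhs_step,
        show ((((j + 1 + 1 + m : ℕ) : ℤ) : ℝ) + 2) = (j : ℝ) + 4 + m by push_cast; ring,
        pow_succ _ (j + 1)]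
      simp only [Polynomial.C_mul]
      ring

theorem chebyshev_U_iterated_derivative (n k : ℕ) (hk : 1 ≤ k) (hkn : k ≤ n) :
    derivative^[k] (U ℝ n) =
      C ((2 : ℝ) ^ k) * ∑ i ∈ Finset.range ((n - k) / 2 + 1),
        C (fallFac ((n : ℝ) - i) (k - 1) * (Nat.choose (k + i - 1) (k - 1) : ℝ)
            * ((n : ℝ) - k - 2 * i + 1))
          * U ℝ ((n - k - 2 * i : ℕ)) := by
  obtain ⟨j, rfl⟩ := Nat.exists_eq_add_of_le' hk
  obtain ⟨m, rfl⟩ := Nat.exists_eq_add_of_le hkn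
  rw [key, rhs, show j + 1 + m - (j + 1) = m by omega]
  congr 1
  refine Finset.sum_congr rfl fun i _ => ?_
  rw [cf, show j + 1 + i - 1 = j + i by omega, Nat.add_sub_cancel]
  congr 3
  · push_cast; rfl
  · push_cast; ring
end

section
/- For every natural number n ≥ 1 and real x, Σ_{k=0}^{n} ( Σ_{i=0}^{⌊(n−k)/2⌋} (−2)^{n−k−2i} · (1/(n−i)) · C(n−i, k+i) · C(n−k−i−1, i) · x^{n−k−2i} ) · T_k(x) = Σ_{k=0}^{n} (1+(−1)^{n−k}) · (k·(−2)^k/(n+k)²) · C((n+k)/2, k)² · x^k + (1/n)·cos(πn/2). -/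
open PowerSeries in
lemma core1 (z y x : ℂ) (hzy : z * y = 1) (hx : z + y = 2 * x) (c : ℕ → ℂ)
    (c0 : c 0 = 1) (c1 : c 1 = 0) (c2 : ∀ n, c (n + 2) = - c n) (n : ℕ) (hn : 1 ≤ n) :
    ∑ d ∈ Finset.range n, (-2 * x) ^ (d + 1) / (d + 1) *
      (∑ ab ∈ Finset.HasAntidiagonal.antidiagonal (n - 1 - d),
        ((d + ab.1).choose d : ℂ) * z ^ ab.1 * (((d + ab.2).choose d : ℂ) * y ^ ab.2))
    = (2 * c n - (z ^ n + y ^ n)) / n := by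
  let W : ℂ → ℂ⟦X⟧ := fun a => PowerSeries.mk fun n => a ^ n
  have hW : ∀ a, W a * (1 - C a * X) = 1 := by
    intro a
    have := congrArg (PowerSeries.rescale a) (mk_one_mul_one_sub_eq_one ℂ)
    rw [map_mul, map_sub, map_one, PowerSeries.rescale_X, PowerSeries.rescale_mk] at this
    simpa [W] using this
  have hWp : ∀ a d, W a ^ (d + 1) = PowerSeries.mk fun n => ((d + n).choose d : ℂ) * a ^ n := by
    intro a d
    have := congrArg (PowerSeries.rescale a) (mk_one_pow_eq_mk_choose_add ℂ d)
    rw [map_pow, PowerSeries.rescale_mk, PowerSeries.rescale_mk] at this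
    simpa [W, mul_comm] using this
  have hWd : ∀ a, d⁄dX ℂ (W a) = C a * W a ^ 2 := by
    intro a
    have h := congrArg (d⁄dX ℂ) (hW a)
    simp [Derivation.leibniz] at h
    linear_combination (W a) * h - (d⁄dX ℂ (W a)) * hW a
  have hzy' : (C z * C y : ℂ⟦X⟧) = 1 := by rw [← map_mul, hzy, map_one]
  have hx' : (C z + C y : ℂ⟦X⟧) = C (2 * x) := by rw [← map_add, hx]
  set R := W z * W y with hR
  set U := C (-2 * x) * X * R with hU
  set G := C z * W z + C y * W y with hG
  have hGc : ∀ k, coeff k G = z ^ (k + 1) + y ^ (k + 1) := by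
    intro k
    simp [G, W, coeff_C_mul, pow_succ, mul_comm]
  let H : ℂ⟦X⟧ := PowerSeries.mk fun n => c (n + 1)
  have hH : H * (1 + X ^ 2) = - X := by
    ext k
    rw [mul_add, mul_one, map_add]
    rcases k with _ | _ | k
    · simp [H, c1, coeff_mul_X_pow']
    · simp [H, c2, c0, coeff_mul_X_pow']
    · rw [show k + 1 + 1 = k + 2 from rfl, coeff_mul_X_pow]
      simp [H, c2, coeff_X]
  have hCm : (C (-2 * x) : ℂ⟦X⟧) = - (C z + C y) := by
    rw [hx', ← map_neg]; congr 1; ring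
  have hQ : R * (1 - (C z + C y) * X + X ^ 2) = 1 := by
    rw [hR]
    linear_combination (W y * (1 - C y * X)) * hW z + hW y - (W z * W y * X ^ 2) * hzy'
  have hGQ : G * (1 - (C z + C y) * X + X ^ 2) = (C z + C y) - 2 * X := by
    rw [hG]
    linear_combination (C z * (1 - C y * X)) * hW z + (C y * (1 - C z * X)) * hW y
      - (C z * W z * X ^ 2 + C y * W y * X ^ 2 + 2 * X) * hzy'
  have hU1 : 1 - U = (1 + X ^ 2) * R := by
    rw [hU, hCm]
    linear_combination - hQ
  have hRd : d⁄dX ℂ R = G * R := by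
    rw [hR, Derivation.leibniz, hWd, hWd, hG]
    simp only [smul_eq_mul]
    ring
  have hUd : d⁄dX ℂ U = (2 * H - G) * (1 - U) := by
    have : d⁄dX ℂ U = C (-2 * x) * (R + X * (G * R)) := by
      rw [hU, mul_assoc, Derivation.leibniz, Derivation.leibniz, hRd]
      simp only [smul_eq_mul, derivative_C, derivative_X]
      ring
    rw [this, hU1, hCm]
    linear_combination (-2 * R) * hH + R * hGQ
  let S : ℂ⟦X⟧ := ∑ d ∈ Finset.range n, C (1 / ((d : ℂ) + 1)) * U ^ (d + 1)
  have hSd : d⁄dX ℂ S = (1 - U ^ n) * (2 * H - G) := by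
    have h1 : d⁄dX ℂ S = ∑ d ∈ Finset.range n, U ^ d * d⁄dX ℂ U := by
      simp only [S, map_sum]
      refine Finset.sum_congr rfl fun d _ => ?_
      rw [Derivation.leibniz, derivative_pow]
      simp only [smul_eq_mul, derivative_C]
      have : (C (1 / ((d : ℂ) + 1)) : ℂ⟦X⟧) * ((d + 1 : ℕ) : ℂ⟦X⟧) = 1 := by
        have h2 : ((d + 1 : ℕ) : ℂ⟦X⟧) = C ((d : ℂ) + 1) := by simp
        rw [h2, ← map_mul, one_div, inv_mul_cancel₀ (by exact_mod_cast Nat.succ_ne_zero d), map_one]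
      rw [Nat.add_sub_cancel]
      linear_combination (U ^ d * d⁄dX ℂ U) * this
    rw [h1, ← Finset.sum_mul, hUd]
    have := geom_sum_mul U n
    linear_combination (-(2 * H - G)) * this
  have hSn : coeff n S * n = 2 * c n - (z ^ n + y ^ n) := by
    obtain ⟨m, rfl⟩ : ∃ m, n = m + 1 := ⟨n - 1, by omega⟩
    have h := congrArg (coeff m) hSd
    rw [coeff_derivative] at h
    have h3 : (1 - U ^ (m + 1)) * (2 * H - G)
        = (2 * H - G) - X ^ (m + 1) * ((C (-2 * x) * R) ^ (m + 1) * (2 * H - G)) := by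
      rw [hU]; ring
    have h4 : (2 * H : ℂ⟦X⟧) = C 2 * H := by rw [map_ofNat]
    rw [h3, map_sub, coeff_X_pow_mul', if_neg (by omega), sub_zero, map_sub, hGc, h4,
      coeff_C_mul] at h
    simpa [H] using h
  have hn0 : (n : ℂ) ≠ 0 := by exact_mod_cast (by omega : n ≠ 0)
  rw [eq_div_iff hn0, ← hSn]
  congr 1
  simp only [S, map_sum]
  refine Finset.sum_congr rfl fun d hd => ?_
  have hd := Finset.mem_range.mp hd
  have : U ^ (d + 1) = C ((-2 * x) ^ (d + 1)) * (X ^ (d + 1) * (W z ^ (d + 1) * W y ^ (d + 1))) := by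
    rw [hU, hR, map_pow]; ring
  rw [this, coeff_C_mul, coeff_C_mul, coeff_X_pow_mul', if_pos (by omega), hWp, hWp, coeff_mul,
    show n - (d + 1) = n - 1 - d by omega]
  simp only [coeff_mk]
  ring

open Polynomial Polynomial.Chebyshev

/-- Generalized binomial coefficient with real upper argument. -/
noncomputable def gbinom (a : ℝ) (m : ℕ) : ℝ := fallFac a m / Nat.factorial m

lemma fold (g : ℕ → ℕ → ℝ) (hg : ∀ a b, g a b = g b a) (p : ℕ) :
    2 * ∑ i ∈ Finset.range (p / 2 + 1), g (p - i) i
      = ∑ ab ∈ Finset.HasAntidiagonal.antidiagonal p, g ab.1 ab.2 + (if Even p then g (p / 2) (p / 2) else 0) := by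
  rw [Finset.Nat.sum_antidiagonal_eq_sum_range_succ g]
  rcases Nat.even_or_odd' p with ⟨q, rfl | rfl⟩
  · have e1 : 2 * q / 2 = q := by omega
    rw [if_pos (by simp), e1, ← Finset.sum_range_add_sum_Ico _ (show q + 1 ≤ (2 * q).succ by omega)]
    have h1 : ∑ i ∈ Finset.Ico (q + 1) (2 * q).succ, g i (2 * q - i)
        = ∑ i ∈ Finset.range q, g (2 * q - i) i := by
      refine Finset.sum_nbij' (fun i => 2 * q - i) (fun i => 2 * q - i) ?_ ?_ ?_ ?_ ?_
      all_goals intro i hi; simp at hi ⊢; try omega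
      congr 1; omega
    have h2 : ∑ i ∈ Finset.range (q + 1), g i (2 * q - i)
        = ∑ i ∈ Finset.range (q + 1), g (2 * q - i) i := Finset.sum_congr rfl fun i _ => hg _ _
    have h3 := Finset.sum_range_succ (fun i => g (2 * q - i) i) q
    rw [show 2 * q - q = q by omega] at h3
    rw [h1, h2]; linarith
  · have e1 : (2 * q + 1) / 2 = q := by omega
    rw [if_neg (by simp), e1, ← Finset.sum_range_add_sum_Ico _
      (show q + 1 ≤ (2 * q + 1).succ by omega)]
    have h1 : ∑ i ∈ Finset.Ico (q + 1) (2 * q + 1).succ, g i (2 * q + 1 - i)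
        = ∑ i ∈ Finset.range (q + 1), g (2 * q + 1 - i) i := by
      refine Finset.sum_nbij' (fun i => 2 * q + 1 - i) (fun i => 2 * q + 1 - i) ?_ ?_ ?_ ?_ ?_
      all_goals intro i hi; simp at hi ⊢; try omega
      congr 1; omega
    have h2 : ∑ i ∈ Finset.range (q + 1), g i (2 * q + 1 - i)
        = ∑ i ∈ Finset.range (q + 1), g (2 * q + 1 - i) i := Finset.sum_congr rfl fun i _ => hg _ _
    rw [h1, h2]; ring

lemma exists_zy (x : ℂ) : ∃ z y : ℂ, z * y = 1 ∧ z + y = 2 * x := by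
  obtain ⟨s, hs⟩ := IsAlgClosed.exists_pow_nat_eq (x ^ 2 - 1) (n := 2) (by norm_num)
  exact ⟨x + s, x - s, by linear_combination -hs, by ring⟩

lemma T_zy (x : ℝ) (z y : ℂ) (hzy : z * y = 1) (hx : z + y = 2 * x) (k : ℕ) :
    (((T ℝ k).eval x : ℝ) : ℂ) * 2 = z ^ k + y ^ k := by
  induction k using Nat.twoStepInduction with
  | zero => simp; norm_num
  | one => simp [hx]; ring
  | more k h0 h1 =>
    push_cast at h0 h1 ⊢
    rw [T_add_two]
    simp only [eval_sub, eval_mul, eval_X, eval_ofNat]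
    push_cast
    linear_combination (2 * (x : ℂ)) * h1 - h0 - (z ^ (k + 1) + y ^ (k + 1)) * hx
      + (z ^ k + y ^ k) * hzy

lemma T_sym (x : ℝ) (z y : ℂ) (hzy : z * y = 1) (hx : z + y = 2 * x) (a b : ℕ) :
    (((T ℝ ((a : ℤ) - b)).eval x : ℝ) : ℂ) * 2 = z ^ a * y ^ b + z ^ b * y ^ a := by
  rcases le_total b a with h | h
  · obtain ⟨k, rfl⟩ := Nat.exists_eq_add_of_le h
    rw [show (((b + k : ℕ) : ℤ) - b) = (k : ℤ) by push_cast; ring, T_zy x z y hzy hx]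
    have : z ^ b * y ^ b = 1 := by rw [← mul_pow, hzy, one_pow]
    rw [pow_add, pow_add]
    linear_combination (-(z ^ k + y ^ k)) * this
  · obtain ⟨k, rfl⟩ := Nat.exists_eq_add_of_le h
    rw [show ((a : ℤ) - ((a + k : ℕ) : ℤ)) = -(k : ℤ) by push_cast; ring, T_neg,
      T_zy x z y hzy hx]
    have : z ^ a * y ^ a = 1 := by rw [← mul_pow, hzy, one_pow]
    rw [pow_add, pow_add]
    linear_combination (-(z ^ k + y ^ k)) * this

lemma core2 (x : ℝ) (n : ℕ) (hn : 1 ≤ n) :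
    ∑ d ∈ Finset.range n, (-2 * x) ^ (d + 1) / (d + 1) *
      (∑ ab ∈ Finset.HasAntidiagonal.antidiagonal (n - 1 - d),
        ((d + ab.1).choose d : ℝ) * ((d + ab.2).choose d : ℝ)
          * (T ℝ ((ab.1 : ℤ) - ab.2)).eval x)
    = (2 * Real.cos (Real.pi * n / 2) - 2 * (T ℝ n).eval x) / n := by
  obtain ⟨z, y, hzy, hx⟩ := exists_zy x
  have h := core1 z y x hzy hx (fun n => (Real.cos (Real.pi * n / 2) : ℝ)) (by simp) (by simp)
    (by
      intro n
      rw [← Complex.ofReal_neg, ← Real.cos_add_pi]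
      congr 2; push_cast; ring) n hn
  rw [← T_zy x z y hzy hx] at h
  apply Complex.ofReal_injective
  push_cast at h ⊢
  rw [mul_comm (eval (x : ℂ) (T ℂ (n : ℤ))) 2] at h
  rw [← h]
  refine Finset.sum_congr rfl fun d _ => ?_
  congr 1
  have hsw := Finset.Nat.sum_antidiagonal_swap (n := n - 1 - d)
    (f := fun ab : ℕ × ℕ => ((d + ab.1).choose d : ℂ) * z ^ ab.1 * (((d + ab.2).choose d : ℂ) * y ^ ab.2))
  apply mul_right_cancel₀ (two_ne_zero : (2 : ℂ) ≠ 0)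
  rw [mul_two (∑ ab ∈ Finset.HasAntidiagonal.antidiagonal (n - 1 - d), ((d + ab.1).choose d : ℂ) * z ^ ab.1 * (((d + ab.2).choose d : ℂ) * y ^ ab.2))]
  nth_rewrite 1 [← hsw]
  rw [← Finset.sum_add_distrib, Finset.sum_mul]
  refine Finset.sum_congr rfl fun ab _ => ?_
  have hs := T_sym x z y hzy hx ab.1 ab.2
  push_cast at hs
  rw [mul_assoc, hs]
  simp only [Prod.fst_swap, Prod.snd_swap]
  ring

lemma gbinom_nat (d i : ℕ) : gbinom ((d : ℝ) + i) i = ((d + i).choose d : ℝ) := by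
  have h : fallFac ((d : ℝ) + i) i = ((d + i).descFactorial i : ℝ) := by
    rw [Nat.descFactorial_eq_prod_range, fallFac, Nat.cast_prod]
    refine Finset.prod_congr rfl fun j hj => ?_
    have := Finset.mem_range.mp hj
    rw [Nat.cast_sub (by omega)]; push_cast; ring
  rw [gbinom, h, Nat.choose_symm_add, Nat.choose_eq_descFactorial_div_factorial,
    Nat.cast_div (Nat.factorial_dvd_descFactorial _ _) (by positivity)]

lemma gbinom_zero (i : ℕ) (hi : 1 ≤ i) : gbinom ((i : ℝ) - 1) i = 0 := by
  rw [gbinom, fallFac, Finset.prod_eq_zero (i := i - 1), zero_div]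
  · simp; omega
  · rw [Nat.cast_sub hi]; simp

lemma choose_shift (d a : ℕ) :
    ((d + 1 + a).choose a : ℝ) / ((d : ℝ) + 1 + a) = ((d + a).choose d : ℝ) / (d + 1) := by
  have h := Nat.add_one_mul_choose_eq (d + a) d
  have h2 : (d + 1 + a).choose a = (d + a + 1).choose (d + 1) := by
    rw [show d + a + 1 = d + 1 + a by ring, Nat.choose_symm_add]
  rw [h2, div_eq_div_iff (by positivity) (by positivity)]
  have h' : (((d + a + 1) * (d + a).choose d : ℕ) : ℝ)
    = (((d + a + 1).choose (d + 1) * (d + 1) : ℕ) : ℝ) := by rw [h]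
  push_cast at h'
  linarith

noncomputable def gT (x : ℝ) (d a b : ℕ) : ℝ :=
  ((d + a).choose d : ℝ) * ((d + b).choose d : ℝ) * (T ℝ ((a : ℤ) - b)).eval x

lemma gT_symm (x : ℝ) (d a b : ℕ) : gT x d a b = gT x d b a := by
  unfold gT
  rw [← T_neg ℝ ((b : ℤ) - a), neg_sub]; ring

lemma lhs_eq (n : ℕ) (hn : 1 ≤ n) (x : ℝ) :
    ∑ k ∈ Finset.range (n + 1),
        (∑ i ∈ Finset.range ((n - k) / 2 + 1),
            (-2 : ℝ) ^ (n - k - 2 * i) * (1 / ((n : ℝ) - i))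
              * (Nat.choose (n - i) (k + i) : ℝ)
              * gbinom ((n : ℝ) - k - i - 1) i * x ^ (n - k - 2 * i))
          * (T ℝ k).eval x
    = (∑ d ∈ Finset.range n, (-2 * x) ^ (d + 1) / (d + 1) *
        ∑ i ∈ Finset.range ((n - 1 - d) / 2 + 1), gT x d (n - 1 - d - i) i)
      + (T ℝ n).eval x / n := by
  have h1 : ∑ k ∈ Finset.range (n + 1),
        (∑ i ∈ Finset.range ((n - k) / 2 + 1),
            (-2 : ℝ) ^ (n - k - 2 * i) * (1 / ((n : ℝ) - i))
              * (Nat.choose (n - i) (k + i) : ℝ)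
              * gbinom ((n : ℝ) - k - i - 1) i * x ^ (n - k - 2 * i))
          * (T ℝ k).eval x
      = ∑ m ∈ Finset.range (n + 1), ∑ i ∈ Finset.range ((n - m) / 2 + 1),
          (-2 * x) ^ m * (1 / ((n : ℝ) - i)) * (Nat.choose (n - i) (n - m - i) : ℝ)
            * gbinom ((m : ℝ) + i - 1) i * (T ℝ ((n - m - 2 * i : ℕ) : ℤ)).eval x := by
    simp only [Finset.sum_mul]
    rw [Finset.sum_sigma', Finset.sum_sigma']
    refine Finset.sum_nbij' (fun s => ⟨n - s.1 - 2 * s.2, s.2⟩) (fun s => ⟨n - s.1 - 2 * s.2, s.2⟩)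
      ?_ ?_ ?_ ?_ ?_
    · rintro ⟨k, i⟩ h; simp at h ⊢; omega
    · rintro ⟨k, i⟩ h; simp at h ⊢; omega
    · rintro ⟨k, i⟩ h; simp at h ⊢; omega
    · rintro ⟨k, i⟩ h; simp at h ⊢; omega
    · rintro ⟨k, i⟩ h
      simp only [Finset.mem_sigma, Finset.mem_range] at h
      obtain ⟨m, rfl⟩ : ∃ m, n = k + 2 * i + m := ⟨n - k - 2 * i, by omega⟩
      dsimp only
      rw [show k + 2 * i + m - k - 2 * i = m by omega,
        show k + 2 * i + m - m - 2 * i = k by omega,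
        show k + 2 * i + m - m - i = k + i by omega,
        show (((k + 2 * i + m : ℕ) : ℝ) - k - i - 1) = (m : ℝ) + i - 1 by push_cast; ring, mul_pow]
      ring
  rw [h1, Finset.sum_range_succ']
  congr 1
  · refine Finset.sum_congr rfl fun d hd => ?_
    have hd := Finset.mem_range.mp hd
    rw [Finset.mul_sum, show n - (d + 1) = n - 1 - d by omega]
    refine Finset.sum_congr rfl fun i hi => ?_
    have hi := Finset.mem_range.mp hi
    obtain ⟨k, rfl⟩ : ∃ k, n = d + 1 + k + 2 * i := ⟨n - 1 - d - 2 * i, by omega⟩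
    have hc := choose_shift d (k + i)
    have hb := gbinom_nat d i
    rw [show d + 1 + k + 2 * i - 1 - d - i = k + i by omega,
      show d + 1 + k + 2 * i - 1 - d - 2 * i = k by omega,
      show d + 1 + k + 2 * i - i = d + 1 + (k + i) by omega,
      show (((d + 1 : ℕ) : ℝ) + i - 1) = (d : ℝ) + i by push_cast; ring, hb, gT,
      show (((k + i : ℕ) : ℤ) - i) = (k : ℤ) by push_cast; ring,
      show (((d + 1 + k + 2 * i : ℕ) : ℝ) - i) = (d : ℝ) + 1 + ((k + i : ℕ) : ℝ) by push_cast; ring]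
    linear_combination ((-2 * x) ^ (d + 1) * ((d + i).choose d : ℝ) * (T ℝ (k : ℤ)).eval x) * hc
  · rw [Finset.sum_eq_single 0]
    · simp [gbinom, fallFac]; ring
    · intro i _ hi
      have := gbinom_zero i (by omega)
      simp [this]
    · simp

lemma rhs_eq (n : ℕ) (x : ℝ) :
    (∑ k ∈ Finset.range (n + 1),
        (1 + (-1 : ℝ) ^ (n - k)) * ((k : ℝ) * (-2 : ℝ) ^ k / ((n : ℝ) + k) ^ 2)
          * (Nat.choose ((n + k) / 2) k : ℝ) ^ 2 * x ^ k)
    = ∑ d ∈ Finset.range n, (-2 * x) ^ (d + 1) / (d + 1) *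
        ((if Even (n - 1 - d) then gT x d ((n - 1 - d) / 2) ((n - 1 - d) / 2) else 0) / 2) := by
  rw [Finset.sum_range_succ']
  simp only [Nat.cast_zero, zero_mul, zero_div, mul_zero, add_zero]
  refine Finset.sum_congr rfl fun d hd => ?_
  have hd := Finset.mem_range.mp hd
  rw [show n - (d + 1) = n - 1 - d by omega]
  rcases Nat.even_or_odd' (n - 1 - d) with ⟨q, hq | hq⟩
  · obtain rfl : n = d + 1 + 2 * q := by omega
    have hc := choose_shift d q
    rw [← Nat.choose_symm_add (a := d + 1) (b := q)] at hc
    rw [hq, if_pos (by simp), show 2 * q / 2 = q by omega,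
      show (d + 1 + 2 * q + (d + 1)) / 2 = d + 1 + q by omega, gT, sub_self, T_zero, eval_one,
      pow_mul]
    have e : (((d + 1 + 2 * q : ℕ) : ℝ) + ((d + 1 : ℕ) : ℝ)) = 2 * ((d : ℝ) + 1 + q) := by
      push_cast; ring
    have h0 : (d : ℝ) + 1 + q ≠ 0 := by positivity
    have h1 : (d : ℝ) + 1 ≠ 0 := by positivity
    have hc' : ((d + 1 + q).choose (d + 1) : ℝ)
      = ((d + q).choose d : ℝ) / (d + 1) * ((d : ℝ) + 1 + q) := by
      rw [← hc]; field_simp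
    rw [e, hc', mul_pow (-2) x]
    push_cast
    field_simp
    norm_num
  · rw [hq, if_neg (by simp), Odd.neg_one_pow (by simp)]
    simp

theorem chebyshev_T_reordered_identity (n : ℕ) (hn : 1 ≤ n) (x : ℝ) :
    ∑ k ∈ Finset.range (n + 1),
        (∑ i ∈ Finset.range ((n - k) / 2 + 1),
            (-2 : ℝ) ^ (n - k - 2 * i) * (1 / ((n : ℝ) - i))
              * (Nat.choose (n - i) (k + i) : ℝ)
              * gbinom ((n : ℝ) - k - i - 1) i * x ^ (n - k - 2 * i))
          * (T ℝ k).eval x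
    = (∑ k ∈ Finset.range (n + 1),
        (1 + (-1 : ℝ) ^ (n - k)) * ((k : ℝ) * (-2 : ℝ) ^ k / ((n : ℝ) + k) ^ 2)
          * (Nat.choose ((n + k) / 2) k : ℝ) ^ 2 * x ^ k)
      + (1 / (n : ℝ)) * Real.cos (Real.pi * n / 2) := by
  rw [lhs_eq n hn x, rhs_eq n x]
  have h := core2 x n hn
  have key : ∑ d ∈ Finset.range n, (-2 * x) ^ (d + 1) / (d + 1) *
        ∑ i ∈ Finset.range ((n - 1 - d) / 2 + 1), gT x d (n - 1 - d - i) i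
      = (∑ d ∈ Finset.range n, (-2 * x) ^ (d + 1) / (d + 1) *
      (∑ ab ∈ Finset.HasAntidiagonal.antidiagonal (n - 1 - d),
        ((d + ab.1).choose d : ℝ) * ((d + ab.2).choose d : ℝ)
          * (T ℝ ((ab.1 : ℤ) - ab.2)).eval x)) / 2
      + ∑ d ∈ Finset.range n, (-2 * x) ^ (d + 1) / (d + 1) *
        ((if Even (n - 1 - d) then gT x d ((n - 1 - d) / 2) ((n - 1 - d) / 2) else 0) / 2) := by
    rw [Finset.sum_div, ← Finset.sum_add_distrib]
    refine Finset.sum_congr rfl fun d _ => ?_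
    have hf := fold (gT x d) (gT_symm x d) (n - 1 - d)
    have hg : ∑ ab ∈ Finset.HasAntidiagonal.antidiagonal (n - 1 - d), gT x d ab.1 ab.2
      = ∑ ab ∈ Finset.HasAntidiagonal.antidiagonal (n - 1 - d),
        ((d + ab.1).choose d : ℝ) * ((d + ab.2).choose d : ℝ)
          * (T ℝ ((ab.1 : ℤ) - ab.2)).eval x := rfl
    rw [← hg]
    linear_combination ((-2 * x) ^ (d + 1) / (d + 1) / 2) * hf
  rw [key, h]
  ring
end
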